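/- Let A = ℤ[b₁, b₂, …] be the polynomial ring over ℤ in variables b(k) for k ≥ 1, set b(0) = 1, and let Δ : A → A ⊗_ℤ A be the unique ℤ-algebra homomorphism with Δ(b(n)) = ∑_{i=0}^{n} b(i) ⊗ b(n−i) for all n ≥ 1. Let N be the Newton sequence of the sequence of variables b. Then for every n ≥ 1 the element N(n) is primitive: Δ(N(n)) = N(n) ⊗ 1 + 1 ⊗ N(n). -/

import Mathlib

/-- The Newton sequence of a sequence `t : ℕ → R`:
`N 0 = 0`, `N 1 = t 1`, and for `n ≥ 2`,
`N n = (∑_{k=1}^{n-1} (-1)^(k-1) * t k * N (n-k)) + (-1)^(n-1) * n * t n`. -/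
noncomputable def newton {R : Type*} [CommRing R] (t : ℕ → R) : ℕ → R
  | 0 => 0
  | 1 => t 1
  | n + 2 =>
      (∑ k ∈ (Finset.Icc 1 (n + 1)).attach,
        (-1 : R) ^ ((k : ℕ) - 1) * t (k : ℕ) * newton t (n + 2 - (k : ℕ)))
      + (-1 : R) ^ (n + 1) * ((n + 2 : ℕ) : R) * t (n + 2)
decreasing_by
  have hk := k.2
  simp only [Finset.mem_Icc] at hk
  omega

theorem newton_series {R : Type*} [CommRing R] (t : ℕ → R) (h0 : t 0 = 1) :
    PowerSeries.mk (fun n => (-1 : R) ^ n * t n) * PowerSeries.mk (newton t) =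
      - (PowerSeries.X * PowerSeries.derivative _ (PowerSeries.mk (fun n => (-1 : R) ^ n * t n))) := by
  ext n
  match n with
  | 0 => simp [PowerSeries.coeff_mul, newton]
  | 1 =>
    rw [map_neg, PowerSeries.coeff_succ_X_mul, PowerSeries.coeff_derivative,
      PowerSeries.coeff_mul, Finset.Nat.sum_antidiagonal_eq_sum_range_succ_mk]
    simp [Finset.sum_range_succ, newton, h0]
  | n + 2 =>
    rw [map_neg, PowerSeries.coeff_succ_X_mul, PowerSeries.coeff_derivative,
      PowerSeries.coeff_mul, Finset.Nat.sum_antidiagonal_eq_sum_range_succ_mk]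
    simp only [PowerSeries.coeff_mk]
    rw [Finset.sum_range_succ, Finset.sum_range_succ']
    have key : newton t (n + 2) = (∑ k ∈ Finset.range (n + 1),
        (-1 : R) ^ k * t (k + 1) * newton t (n + 2 - (k + 1)))
        + (-1 : R) ^ (n + 1) * ((n + 2 : ℕ) : R) * t (n + 2) := by
      rw [newton]
      congr 1
      rw [Finset.sum_attach (Finset.Icc 1 (n + 1)) (fun k =>
        (-1 : R) ^ (k - 1) * t k * newton t (n + 2 - k))]
      rw [← Finset.Ico_add_one_right_eq_Icc, Finset.sum_Ico_eq_sum_range]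
      apply Finset.sum_congr (by simp)
      intro k _
      rw [add_comm 1 k]
      simp
    have hz : newton t (n + 2 - (n + 2)) = 0 := by simp [newton]
    rw [hz, Nat.sub_zero, key, h0]
    have hs : ∑ k ∈ Finset.range (n + 1), (-1 : R) ^ (k + 1) * t (k + 1) * newton t (n + 2 - (k + 1))
        = - ∑ k ∈ Finset.range (n + 1), (-1 : R) ^ k * t (k + 1) * newton t (n + 2 - (k + 1)) := by
      rw [← Finset.sum_neg_distrib]
      exact Finset.sum_congr rfl fun k _ => by ring
    rw [hs]
    push_cast
    ring

theorem newton_map {R S : Type*} [CommRing R] [CommRing S] (f : R →+* S) (t : ℕ → R) (h0 : t 0 = 1) :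
    PowerSeries.mk (fun n => (-1 : S) ^ n * f (t n)) * PowerSeries.mk (fun n => f (newton t n)) =
      - (PowerSeries.X *
        PowerSeries.derivative _ (PowerSeries.mk (fun n => (-1 : S) ^ n * f (t n)))) := by
  have h := congrArg (PowerSeries.map f) (newton_series t h0)
  rw [map_mul, map_neg, map_mul, PowerSeries.map_X] at h
  have e1 : PowerSeries.map f (PowerSeries.mk (fun n => (-1 : R) ^ n * t n)) =
      PowerSeries.mk (fun n => (-1 : S) ^ n * f (t n)) := by ext; simp
  have e2 : PowerSeries.map f (PowerSeries.mk (newton t)) =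
      PowerSeries.mk (fun n => f (newton t n)) := by ext; simp
  have e3 : PowerSeries.map f (PowerSeries.derivative _
      (PowerSeries.mk (fun n => (-1 : R) ^ n * t n))) =
      PowerSeries.derivative _ (PowerSeries.mk (fun n => (-1 : S) ^ n * f (t n))) := by
    ext; simp [PowerSeries.coeff_derivative]
  rw [e1, e2, e3] at h
  exact h

open MvPolynomial TensorProduct in
/-- In `A = ℤ[b₁, b₂, …]` (formally `MvPolynomial ℕ+ ℤ`) with `b 0 = 1` and
`b k = X k` for `k ≥ 1`, if `Δ : A →ₐ[ℤ] A ⊗[ℤ] A` is the (unique) ℤ-algebra map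
with `Δ (b n) = ∑_{i=0}^n b i ⊗ b (n - i)` for `n ≥ 1`, then every Newton element
`N n`, `n ≥ 1`, is primitive: `Δ (N n) = N n ⊗ 1 + 1 ⊗ N n`. -/
theorem newton_primitive
    (b : ℕ → MvPolynomial ℕ+ ℤ) (hb0 : b 0 = 1)
    (hb : ∀ k : ℕ+, b k = X k)
    (Δ : MvPolynomial ℕ+ ℤ →ₐ[ℤ] MvPolynomial ℕ+ ℤ ⊗[ℤ] MvPolynomial ℕ+ ℤ)
    (hΔ : ∀ n : ℕ, 1 ≤ n →
      Δ (b n) = ∑ i ∈ Finset.range (n + 1), b i ⊗ₜ[ℤ] b (n - i)) :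
    ∀ n : ℕ, 1 ≤ n →
      Δ (newton b n) = newton b n ⊗ₜ[ℤ] 1 + 1 ⊗ₜ[ℤ] newton b n := by
  intro n _
  let i1 : MvPolynomial ℕ+ ℤ →+* MvPolynomial ℕ+ ℤ ⊗[ℤ] MvPolynomial ℕ+ ℤ :=
    Algebra.TensorProduct.includeLeftRingHom
  let i2 : MvPolynomial ℕ+ ℤ →+* MvPolynomial ℕ+ ℤ ⊗[ℤ] MvPolynomial ℕ+ ℤ :=
    (Algebra.TensorProduct.includeRight :
      MvPolynomial ℕ+ ℤ →ₐ[ℤ] MvPolynomial ℕ+ ℤ ⊗[ℤ] MvPolynomial ℕ+ ℤ).toRingHom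
  have hi1 : ∀ x, i1 x = x ⊗ₜ[ℤ] 1 := fun x => rfl
  have hi2 : ∀ x, i2 x = 1 ⊗ₜ[ℤ] x := fun x => rfl
  let D : MvPolynomial ℕ+ ℤ →+* MvPolynomial ℕ+ ℤ ⊗[ℤ] MvPolynomial ℕ+ ℤ := Δ.toRingHom
  have hD : ∀ x, D x = Δ x := fun x => rfl
  have h1 := newton_map i1 b hb0
  have h2 := newton_map i2 b hb0
  have h := newton_map D b hb0
  have hE : PowerSeries.mk (fun n => (-1) ^ n * D (b n)) =
      PowerSeries.mk (fun n => (-1) ^ n * i1 (b n)) *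
        PowerSeries.mk (fun n => (-1) ^ n * i2 (b n)) := by
    ext m
    rw [PowerSeries.coeff_mul, Finset.Nat.sum_antidiagonal_eq_sum_range_succ_mk]
    simp only [PowerSeries.coeff_mk]
    have hm : D (b m) = ∑ i ∈ Finset.range (m + 1), b i ⊗ₜ[ℤ] b (m - i) := by
      rcases Nat.eq_zero_or_pos m with rfl | hm
      · simp [hb0, hD, Algebra.TensorProduct.one_def]
      · exact hΔ m hm
    rw [hm, Finset.mul_sum]
    refine Finset.sum_congr rfl fun i hi => ?_
    have hle : i ≤ m := by simpa [Nat.lt_succ_iff] using hi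
    have hp : b i ⊗ₜ[ℤ] b (m - i) = i1 (b i) * i2 (b (m - i)) := by
      rw [hi1, hi2, Algebra.TensorProduct.tmul_mul_tmul, one_mul, mul_one]
    obtain ⟨j, rfl⟩ := Nat.exists_eq_add_of_le hle
    rw [hp, Nat.add_sub_cancel_left, pow_add]
    ring
  have hu : IsUnit (PowerSeries.mk (fun n => (-1) ^ n * D (b n))) := by
    rw [PowerSeries.isUnit_iff_constantCoeff, ← PowerSeries.coeff_zero_eq_constantCoeff_apply]
    simp [hb0]
  have hP : PowerSeries.mk (fun n => D (newton b n)) =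
      PowerSeries.mk (fun n => i1 (newton b n)) + PowerSeries.mk (fun n => i2 (newton b n)) := by
    apply hu.mul_left_cancel
    rw [h, hE, Derivation.leibniz, smul_eq_mul, smul_eq_mul]
    linear_combination -(PowerSeries.mk (fun n => (-1) ^ n * i2 (b n))) * h1 -
      (PowerSeries.mk (fun n => (-1) ^ n * i1 (b n))) * h2
  have := congrArg (PowerSeries.coeff n) hP
  simpa [hi1, hi2, hD] using this
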